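/- Let ℓ ≥ 1 be an integer and let p > 2 be a real number. Then there exists a constant C = C(ℓ, p) > 0 such that for all complex numbers a₁, …, a_ℓ, | |Σ_{j=1}^{ℓ} a_j|^p − Σ_{j=1}^{ℓ} |a_j|^p | ≤ C Σ_{j ≠ k} |a_j| |a_k|^{p−1}, where the last sum runs over all ordered pairs (j, k) with 1 ≤ j, k ≤ ℓ and j ≠ k. -/

import Mathlib

open Finset

/-- On `[0, K]` the map `x ↦ x ^ p` is Lipschitz with constant `p * K ^ (p - 1)`. -/
theorem abs_rpow_sub_rpow_le {p K x y : ℝ} (hp : 1 ≤ p) (hx : x ∈ Set.Icc 0 K)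
    (hy : y ∈ Set.Icc 0 K) : |y ^ p - x ^ p| ≤ p * K ^ (p - 1) * |y - x| := by
  refine (convex_Icc 0 K).norm_image_sub_le_of_norm_hasDerivWithin_le (f := fun t : ℝ => t ^ p)
    (f' := fun t => p * t ^ (p - 1))
    (fun t _ => (Real.hasDerivAt_rpow_const (Or.inr hp)).hasDerivWithinAt) (fun t ht => ?_) hx hy
  have h0 : 0 ≤ t ^ (p - 1) := Real.rpow_nonneg ht.1 _
  rw [Real.norm_of_nonneg (by positivity)]
  have : t ^ (p - 1) ≤ K ^ (p - 1) := Real.rpow_le_rpow ht.1 ht.2 (by linarith)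
  gcongr

/-- If `a m` has the largest norm, the decoupling error is controlled by the pairs `(j, m)`. -/
theorem abs_norm_sum_rpow_sub_sum_le {ι E : Type*} [Fintype ι] [DecidableEq ι]
    [SeminormedAddCommGroup E] {p : ℝ} (hp : 1 ≤ p) (a : ι → E) (m : ι)
    (hm : ∀ j, ‖a j‖ ≤ ‖a m‖) :
    |‖∑ j, a j‖ ^ p - ∑ j, ‖a j‖ ^ p| ≤
      (p * (Fintype.card ι : ℝ) ^ (p - 1) + 1) *
        ∑ j ∈ univ.erase m, ‖a j‖ * ‖a m‖ ^ (p - 1) := by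
  set n : ℝ := (Fintype.card ι : ℝ) with hn_def
  have hn : 1 ≤ n := Nat.one_le_cast.2 (Fintype.card_pos_iff.2 ⟨m⟩)
  have hsum : ‖∑ j, a j‖ ≤ n * ‖a m‖ := by
    refine (norm_sum_le _ _).trans ((sum_le_card_nsmul univ _ _ fun j _ => hm j).trans ?_)
    simp [hn_def]
  have hdiff : |‖∑ j, a j‖ - ‖a m‖| ≤ ∑ j ∈ univ.erase m, ‖a j‖ := by
    refine (abs_norm_sub_norm_le _ _).trans ?_
    rw [← add_sum_erase univ a (mem_univ m), add_sub_cancel_left]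
    exact norm_sum_le _ _
  have hmain := abs_rpow_sub_rpow_le hp (K := n * ‖a m‖)
    ⟨norm_nonneg _, le_mul_of_one_le_left (norm_nonneg (a m)) hn⟩ ⟨norm_nonneg _, hsum⟩
  rw [Real.mul_rpow (by positivity) (norm_nonneg _)] at hmain
  have hrest : ∑ j ∈ univ.erase m, ‖a j‖ ^ p ≤
      ∑ j ∈ univ.erase m, ‖a j‖ * ‖a m‖ ^ (p - 1) := by
    refine sum_le_sum fun j _ => ?_
    calc ‖a j‖ ^ p = ‖a j‖ * ‖a j‖ ^ (p - 1) := by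
          rw [← Real.rpow_one_add' (norm_nonneg _) (by linarith), add_sub_cancel]
      _ ≤ _ := by
          gcongr
          exact hm j
  have hrest_nonneg : 0 ≤ ∑ j ∈ univ.erase m, ‖a j‖ ^ p := by positivity
  rw [← add_sum_erase univ (fun j => ‖a j‖ ^ p) (mem_univ m), ← sub_sub]
  calc _ ≤ |‖∑ j, a j‖ ^ p - ‖a m‖ ^ p| + |∑ j ∈ univ.erase m, ‖a j‖ ^ p| := abs_sub _ _
    _ ≤ p * (n ^ (p - 1) * ‖a m‖ ^ (p - 1)) * ∑ j ∈ univ.erase m, ‖a j‖ +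
        ∑ j ∈ univ.erase m, ‖a j‖ * ‖a m‖ ^ (p - 1) := by
          rw [abs_of_nonneg hrest_nonneg]
          exact add_le_add (hmain.trans (by gcongr)) hrest
    _ = _ := by
          rw [← sum_mul]
          ring

/-- **Elementary decoupling inequality.** For `ℓ ≥ 1` and `p > 2` there is `C > 0` such that
for all complex `a₁, …, a_ℓ`,
`| |Σ a_j|^p − Σ |a_j|^p | ≤ C Σ_{j ≠ k} |a_j| |a_k|^{p−1}`. -/
theorem stmt10 (ℓ : ℕ) (hℓ : 1 ≤ ℓ) (p : ℝ) (hp : 2 < p) :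
    ∃ C : ℝ, 0 < C ∧ ∀ a : Fin ℓ → ℂ,
      |‖∑ j : Fin ℓ, a j‖ ^ p - ∑ j : Fin ℓ, ‖a j‖ ^ p| ≤
        C * ∑ j : Fin ℓ, ∑ k : Fin ℓ,
          if j ≠ k then ‖a j‖ * ‖a k‖ ^ (p - 1) else 0 := by
  have hC : 0 < p * (ℓ : ℝ) ^ (p - 1) + 1 := by positivity
  refine ⟨_, hC, fun a => ?_⟩
  have : Nonempty (Fin ℓ) := ⟨⟨0, hℓ⟩⟩
  obtain ⟨m, hm⟩ := Finite.exists_max fun j => ‖a j‖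
  have h := abs_norm_sum_rpow_sub_sum_le (by linarith : 1 ≤ p) a m hm
  rw [Fintype.card_fin] at h
  refine h.trans (mul_le_mul_of_nonneg_left ?_ hC.le)
  have hnonneg (j k : Fin ℓ) : 0 ≤ if j ≠ k then ‖a j‖ * ‖a k‖ ^ (p - 1) else 0 := by
    split_ifs <;> positivity
  calc _ = ∑ j ∈ univ.erase m, if j ≠ m then ‖a j‖ * ‖a m‖ ^ (p - 1) else 0 :=
        sum_congr rfl fun j hj => (if_pos (ne_of_mem_erase hj)).symm
    _ ≤ ∑ j, if j ≠ m then ‖a j‖ * ‖a m‖ ^ (p - 1) else 0 :=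
        sum_le_sum_of_subset_of_nonneg (erase_subset _ _) fun j _ _ => hnonneg j m
    _ ≤ _ := sum_le_sum fun j _ =>
        single_le_sum (f := fun k => if j ≠ k then ‖a j‖ * ‖a k‖ ^ (p - 1) else 0)
          (fun k _ => hnonneg j k) (mem_univ m)
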